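/- Let N ≥ 1, identify ℝ^N with ℝ × ℝ^{N−1}, and let f : ℝ^N → ℝ be continuous and locally integrable. Suppose there is a set Y ⊆ ℝ^{N−1} of positive (N−1)-dimensional Lebesgue outer measure such that for every y ∈ Y there is NO locally integrable h : ℝ → ℝ with f(b,y) − f(a,y) = ∫_a^b h(t) dt for all real a ≤ b (i.e., t ↦ f(t,y) is not absolutely continuous on the line through y parallel to the first axis). Then f has no weak partial derivative in the first coordinate direction: there is no locally integrable g : ℝ^N → ℝ such that ∫_{ℝ^N} f ∂₁φ dx = −∫_{ℝ^N} g φ dx for every smooth compactly supported φ : ℝ^N → ℝ. -/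

import Mathlib

open MeasureTheory Filter Topology Set

/-- The smooth transition from `0` to `1` that takes place on `[a, a + 1 / c]`. -/
noncomputable def smoothStep (c a t : ℝ) : ℝ := Real.smoothTransition (c * (t - a))

theorem contDiff_smoothStep (c a : ℝ) : ContDiff ℝ (⊤ : ℕ∞) (smoothStep c a) :=
  Real.smoothTransition.contDiff.comp (contDiff_const.mul (contDiff_id.sub contDiff_const))

theorem smoothStep_of_le {c a t : ℝ} (hc : 0 ≤ c) (ht : t ≤ a) : smoothStep c a t = 0 :=
  Real.smoothTransition.zero_of_nonpos
    (mul_nonpos_of_nonneg_of_nonpos hc (sub_nonpos.2 ht))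

theorem smoothStep_of_one_le {c a t : ℝ} (h : 1 ≤ c * (t - a)) : smoothStep c a t = 1 :=
  Real.smoothTransition.one_of_one_le h

theorem tendsto_smoothStep (a t : ℝ) :
    Tendsto (fun n : ℕ => smoothStep (n + 1) a t) atTop (𝓝 ((Ioi a).indicator 1 t)) := by
  by_cases ht : a < t
  · rw [indicator_of_mem (mem_Ioi.2 ht)]
    have h : Tendsto (fun n : ℕ => ((n : ℝ) + 1) * (t - a)) atTop atTop :=
      (tendsto_natCast_atTop_atTop.atTop_add tendsto_const_nhds).atTop_mul_const (sub_pos.2 ht)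
    refine tendsto_const_nhds.congr' ?_
    filter_upwards [h.eventually_ge_atTop 1] with n hn
    exact (smoothStep_of_one_le hn).symm
  · rw [indicator_of_notMem (by simpa using ht)]
    refine tendsto_const_nhds.congr fun n => ?_
    exact (smoothStep_of_le (by positivity) (not_lt.1 ht)).symm

theorem continuous_deriv_smoothTransition : Continuous (deriv Real.smoothTransition) :=
  (Real.smoothTransition.contDiff (n := 1)).continuous_deriv le_rfl

theorem deriv_smoothTransition_eq_zero {u : ℝ} (hu : u ∉ Icc (0 : ℝ) 1) :
    deriv Real.smoothTransition u = 0 := by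
  rw [mem_Icc, not_and_or, not_le, not_le] at hu
  rcases hu with hu | hu
  · have h : Real.smoothTransition =ᶠ[𝓝 u] fun _ => 0 := by
      filter_upwards [Iio_mem_nhds hu] with v hv
      exact Real.smoothTransition.zero_of_nonpos (le_of_lt hv)
    rw [h.deriv_eq, deriv_const]
  · have h : Real.smoothTransition =ᶠ[𝓝 u] fun _ => 1 := by
      filter_upwards [Ioi_mem_nhds hu] with v hv
      exact Real.smoothTransition.one_of_one_le (le_of_lt hv)
    rw [h.deriv_eq, deriv_const]

theorem hasCompactSupport_deriv_smoothTransition :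
    HasCompactSupport (deriv Real.smoothTransition) :=
  HasCompactSupport.intro isCompact_Icc fun _ => deriv_smoothTransition_eq_zero

theorem integral_deriv_smoothTransition : ∫ u, deriv Real.smoothTransition u = 1 := by
  have hsub : Function.support (deriv Real.smoothTransition) ⊆ Ioc (-1) 2 := by
    intro u hu
    have h : u ∈ Icc (0 : ℝ) 1 := not_imp_comm.1 deriv_smoothTransition_eq_zero hu
    exact ⟨by linarith [h.1], by linarith [h.2]⟩
  rw [← intervalIntegral.integral_eq_integral_of_support_subset hsub,
    intervalIntegral.integral_deriv_eq_sub
      (fun x _ => (Real.smoothTransition.contDiff (n := 1)).differentiable one_ne_zero x)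
      (continuous_deriv_smoothTransition.intervalIntegrable _ _),
    Real.smoothTransition.one_of_one_le (by norm_num),
    Real.smoothTransition.zero_of_nonpos (by norm_num), sub_zero]

theorem deriv_smoothStep (c a t : ℝ) :
    deriv (smoothStep c a) t = c * deriv Real.smoothTransition (c * (t - a)) := by
  have h := ((Real.smoothTransition.contDiff (n := 1)).differentiable one_ne_zero
    (c * (t - a))).hasDerivAt.comp t (((hasDerivAt_id t).sub_const a).const_mul c)
  rw [mul_one, mul_comm] at h
  exact h.deriv

theorem integral_mul_deriv_smoothStep (F : ℝ → ℝ) {c : ℝ} (hc : 0 < c) (a : ℝ) :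
    ∫ t, F t * deriv (smoothStep c a) t
      = ∫ u, F (a + u / c) * deriv Real.smoothTransition u := by
  have h₁ := integral_sub_right_eq_self (μ := volume)
    (fun t => F (t + a) * (c * deriv Real.smoothTransition (c * t))) a
  have h₂ := Measure.integral_comp_mul_left
    (fun u => c * (F (a + u / c) * deriv Real.smoothTransition u)) c
  rw [integral_const_mul c (fun u => F (a + u / c) * deriv Real.smoothTransition u),
    abs_of_pos (inv_pos.2 hc), smul_eq_mul, ← mul_assoc, inv_mul_cancel₀ hc.ne', one_mul] at h₂
  rw [← h₂]
  simp only [sub_add_cancel] at h₁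
  simp only [deriv_smoothStep]
  rw [h₁]
  refine integral_congr_ae (Eventually.of_forall fun t => ?_)
  simp only [mul_div_cancel_left₀ t hc.ne', add_comm t a]
  ring

theorem integrable_mul_deriv_smoothStep {F : ℝ → ℝ} (hF : Continuous F) {c : ℝ} (hc : 0 < c)
    (a : ℝ) : Integrable fun t => F t * deriv (smoothStep c a) t := by
  refine (hF.mul ((contDiff_smoothStep c a).continuous_deriv
    (by simp))).integrable_of_hasCompactSupport
    (HasCompactSupport.intro (isCompact_Icc (a := a) (b := a + 1 / c)) fun t ht => ?_)
  rw [Pi.mul_apply, deriv_smoothStep, deriv_smoothTransition_eq_zero, mul_zero, mul_zero]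
  refine fun h => ht ⟨?_, ?_⟩
  · linarith [nonneg_of_mul_nonneg_right h.1 hc]
  · have := (le_div_iff₀' hc).2 h.2
    linarith

/-- The derivatives of the smooth steps at `a` form an approximate identity at `a`. -/
theorem tendsto_integral_mul_deriv_smoothStep {F : ℝ → ℝ} (hF : Continuous F) (a : ℝ) :
    Tendsto (fun n : ℕ => ∫ t, F t * deriv (smoothStep (n + 1) a) t) atTop (𝓝 (F a)) := by
  obtain ⟨B, hB⟩ := (isCompact_Icc (a := a) (b := a + 1)).exists_bound_of_continuousOn
    hF.continuousOn
  have hlim : ∫ u, F a * deriv Real.smoothTransition u = F a := by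
    rw [integral_const_mul, integral_deriv_smoothTransition, mul_one]
  rw [← hlim]
  refine (tendsto_integral_of_dominated_convergence
    (F := fun (n : ℕ) u => F (a + u / (n + 1)) * deriv Real.smoothTransition u)
    (fun u => B * ‖deriv Real.smoothTransition u‖) ?_ ?_ ?_ ?_).congr fun n =>
      (integral_mul_deriv_smoothStep F n.cast_add_one_pos a).symm
  · intro n
    exact Continuous.aestronglyMeasurable
      ((hF.comp (by fun_prop)).mul continuous_deriv_smoothTransition)
  · exact ((continuous_deriv_smoothTransition.integrable_of_hasCompactSupport
      hasCompactSupport_deriv_smoothTransition).norm).const_mul B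
  · refine fun n => Eventually.of_forall fun u => ?_
    by_cases hu : u ∈ Icc (0 : ℝ) 1
    · rw [norm_mul]
      refine mul_le_mul_of_nonneg_right (hB _ ⟨?_, ?_⟩) (norm_nonneg _)
      · have : 0 ≤ u / ((n : ℝ) + 1) := div_nonneg hu.1 (by positivity)
        linarith
      · have : u / ((n : ℝ) + 1) ≤ 1 :=
          div_le_one_of_le₀ (hu.2.trans (by simp)) (by positivity)
        linarith
    · simp [deriv_smoothTransition_eq_zero hu]
  · refine Eventually.of_forall fun u => Tendsto.mul_const _ ?_
    refine (hF.tendsto a).comp ?_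
    have h : Tendsto (fun n : ℕ => u / ((n : ℝ) + 1)) atTop (𝓝 0) :=
      tendsto_const_nhds.div_atTop (tendsto_natCast_atTop_atTop.atTop_add tendsto_const_nhds)
    simpa using h.const_add a

theorem smoothStep_sub_smoothStep_eq_zero {a b c t : ℝ} (hab : a ≤ b) (hc : 1 ≤ c)
    (ht : t ∉ Ioc a (b + 1)) : smoothStep c a t - smoothStep c b t = 0 := by
  rw [mem_Ioc, not_and_or, not_lt, not_le] at ht
  rcases ht with ht | ht
  · rw [smoothStep_of_le (by linarith) ht, smoothStep_of_le (by linarith) (ht.trans hab), sub_zero]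
  · rw [smoothStep_of_one_le (by nlinarith), smoothStep_of_one_le (by nlinarith), sub_self]

theorem hasCompactSupport_smoothStep_sub_mul {E : Type*} [TopologicalSpace E] [R1Space E]
    {η : E → ℝ} (hηc : HasCompactSupport η)
    {a b c : ℝ} (hab : a ≤ b) (hc : 1 ≤ c) :
    HasCompactSupport fun x : ℝ × E => (smoothStep c a x.1 - smoothStep c b x.1) * η x.2 := by
  refine HasCompactSupport.intro ((isCompact_Icc (a := a) (b := b + 1)).prod hηc) fun x hx => ?_
  rw [mem_prod, not_and_or] at hx
  rcases hx with hx | hx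
  · rw [smoothStep_sub_smoothStep_eq_zero hab hc fun h => hx (Ioc_subset_Icc_self h), zero_mul]
  · rw [image_eq_zero_of_notMem_tsupport hx, mul_zero]

theorem fderiv_mul_fst_snd_apply {E : Type*} [NormedAddCommGroup E]
    [NormedSpace ℝ E] {ψ : ℝ → ℝ} {η : E → ℝ} (hψ : Differentiable ℝ ψ)
    (hη : Differentiable ℝ η) (x : ℝ × E) :
    fderiv ℝ (fun x : ℝ × E => ψ x.1 * η x.2) x (1, 0) = deriv ψ x.1 * η x.2 := by
  have h₁ := (hψ x.1).hasFDerivAt.comp x hasFDerivAt_fst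
  have h₂ := (hη x.2).hasFDerivAt.comp x hasFDerivAt_snd
  refine (congrArg (· (1, 0)) (h₁.mul h₂).fderiv).trans ?_
  simp [mul_comm]

section Product

variable {E : Type*} [NormedAddCommGroup E] [NormedSpace ℝ E] [FiniteDimensional ℝ E]
  [MeasureSpace E]

theorem integrable_indicator_Ioc_mul [BorelSpace E] {g : ℝ × E → ℝ}
    (hg : LocallyIntegrable g volume)
    {η : E → ℝ} (hη : Continuous η) (hηc : HasCompactSupport η) (a b : ℝ) :
    Integrable fun x : ℝ × E => g x * ((Ioc a b).indicator 1 x.1 * η x.2) := by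
  obtain ⟨C, hC⟩ := hηc.exists_bound_of_continuous hη
  have hS := hg.integrableOn_isCompact ((isCompact_Icc (a := a) (b := b)).prod hηc)
  have hSm : MeasurableSet (Icc a b ×ˢ tsupport η) :=
    measurableSet_Icc.prod (isClosed_tsupport η).measurableSet
  refine ((hS.integrable_indicator hSm).norm.mul_const C).mono ?_ ?_
  · refine hg.aestronglyMeasurable.mul (Measurable.aestronglyMeasurable ?_)
    exact ((measurable_one.indicator measurableSet_Ioc).comp measurable_fst).mul
      (hη.measurable.comp measurable_snd)
  · refine Eventually.of_forall fun x => ?_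
    by_cases h₁ : x.1 ∈ Ioc a b
    · by_cases h₂ : x.2 ∈ tsupport η
      · rw [indicator_of_mem h₁, indicator_of_mem (mk_mem_prod (Ioc_subset_Icc_self h₁) h₂)]
        simp only [Pi.one_apply, one_mul, norm_mul, norm_norm]
        exact mul_le_mul_of_nonneg_left ((hC _).trans (le_abs_self C)) (norm_nonneg _)
      · rw [image_eq_zero_of_notMem_tsupport h₂, mul_zero, mul_zero, norm_zero]
        exact norm_nonneg _
    · rw [indicator_of_notMem h₁, zero_mul, mul_zero, norm_zero]
      exact norm_nonneg _

theorem locallyIntegrable_intervalIntegral_fst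
    [IsLocallyFiniteMeasure (volume : Measure E)] {g : ℝ × E → ℝ}
    (hg : LocallyIntegrable g volume) {a b : ℝ}
    (hab : a ≤ b) : LocallyIntegrable (fun y : E => ∫ t in a..b, g (t, y)) volume := by
  refine locallyIntegrable_iff.2 fun K hK => ?_
  have h := (hg.integrableOn_isCompact ((isCompact_Icc (a := a) (b := b)).prod hK)).mono_set
    (prod_mono_left Ioc_subset_Icc_self)
  rw [IntegrableOn, Measure.volume_eq_prod, ← Measure.prod_restrict] at h
  simpa only [intervalIntegral.integral_of_le hab, IntegrableOn] using h.integral_prod_right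

variable [BorelSpace E] [IsLocallyFiniteMeasure (volume : Measure E)]

theorem tendsto_integral_mul_smoothStep {g : ℝ × E → ℝ} (hg : LocallyIntegrable g volume)
    {η : E → ℝ} (hη : Continuous η) (hηc : HasCompactSupport η) {a b : ℝ} (hab : a ≤ b) :
    Tendsto (fun n : ℕ => ∫ x : ℝ × E,
        g x * ((smoothStep (n + 1) a x.1 - smoothStep (n + 1) b x.1) * η x.2)) atTop
      (𝓝 (∫ y, η y * ∫ t in a..b, g (t, y))) := by
  have hlim : ∫ x : ℝ × E, g x * ((Ioc a b).indicator 1 x.1 * η x.2)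
      = ∫ y, η y * ∫ t in a..b, g (t, y) := by
    rw [Measure.volume_eq_prod, integral_prod_symm _
      (by simpa only [Measure.volume_eq_prod] using integrable_indicator_Ioc_mul hg hη hηc a b)]
    congr 1 with y
    rw [intervalIntegral.integral_of_le hab, ← integral_indicator measurableSet_Ioc,
      ← integral_const_mul]
    congr 1 with t
    by_cases ht : t ∈ Ioc a b <;> simp [ht, mul_comm]
  rw [← hlim]
  refine tendsto_integral_of_dominated_convergence
    (fun x => ‖g x * ((Ioc a (b + 1)).indicator 1 x.1 * η x.2)‖) ?_
    (integrable_indicator_Ioc_mul hg hη hηc a (b + 1)).norm ?_ ?_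
  · intro n
    refine hg.aestronglyMeasurable.mul (Continuous.aestronglyMeasurable ?_)
    exact ((((contDiff_smoothStep _ a).continuous.sub
      (contDiff_smoothStep _ b).continuous).comp continuous_fst).mul (hη.comp continuous_snd))
  · refine fun n => Eventually.of_forall fun x => ?_
    by_cases hx : x.1 ∈ Ioc a (b + 1)
    · rw [indicator_of_mem hx, norm_mul, norm_mul, norm_mul, norm_mul]
      gcongr
      have h₁ : 0 ≤ smoothStep (n + 1) a x.1 := Real.smoothTransition.nonneg _
      have h₂ : smoothStep (n + 1) a x.1 ≤ 1 := Real.smoothTransition.le_one _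
      have h₃ : 0 ≤ smoothStep (n + 1) b x.1 := Real.smoothTransition.nonneg _
      have h₄ : smoothStep (n + 1) b x.1 ≤ 1 := Real.smoothTransition.le_one _
      rw [Pi.one_apply, norm_one, Real.norm_eq_abs, abs_le]
      constructor <;> linarith
    · rw [smoothStep_sub_smoothStep_eq_zero hab (by simp) hx, zero_mul, mul_zero, norm_zero]
      exact norm_nonneg _
  · refine Eventually.of_forall fun x => Tendsto.const_mul _ (Tendsto.mul_const _ ?_)
    have h := (tendsto_smoothStep a x.1).sub (tendsto_smoothStep b x.1)
    have heq : (Ioi a).indicator (1 : ℝ → ℝ) x.1 - (Ioi b).indicator (1 : ℝ → ℝ) x.1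
        = (Ioc a b).indicator 1 x.1 := by
      by_cases h₁ : a < x.1 <;> by_cases h₂ : b < x.1
      · simp [h₁, h₂]
      · simp [h₁, h₂, not_lt.1 h₂]
      · exact absurd (hab.trans_lt h₂) h₁
      · simp [h₁, h₂]
    rwa [heq] at h

theorem continuous_integral_mul_fst {f : ℝ × E → ℝ} (hf : Continuous f) {η : E → ℝ}
    (hη : Continuous η) (hηc : HasCompactSupport η) :
    Continuous fun t => ∫ y, η y * f (t, y) := by
  rw [← continuousOn_univ]
  refine continuousOn_integral_of_compact_support (f := fun t y => η y * f (t, y)) hηc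
    (Continuous.continuousOn ?_) fun t y _ hy => ?_
  · exact (hη.comp continuous_snd).mul hf
  · rw [image_eq_zero_of_notMem_tsupport hy, zero_mul]

variable {f g : ℝ × E → ℝ}

theorem integral_mul_sub_eq_of_weak_deriv (hf : Continuous f)
    (hg : LocallyIntegrable g volume)
    (hfg : ∀ φ : ℝ × E → ℝ, ContDiff ℝ (⊤ : ℕ∞) φ → HasCompactSupport φ →
      ∫ x, f x * fderiv ℝ φ x (1, 0) = -∫ x, g x * φ x)
    {η : E → ℝ} (hη : ContDiff ℝ (⊤ : ℕ∞) η) (hηc : HasCompactSupport η)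
    {a b : ℝ} (hab : a ≤ b) :
    (∫ y, η y * f (b, y)) - ∫ y, η y * f (a, y) = ∫ y, η y * ∫ t in a..b, g (t, y) := by
  have hF := continuous_integral_mul_fst hf hη.continuous hηc
  have hleft := (tendsto_integral_mul_deriv_smoothStep hF b).sub
    (tendsto_integral_mul_deriv_smoothStep hF a)
  refine tendsto_nhds_unique hleft
    ((tendsto_integral_mul_smoothStep hg hη.continuous hηc hab).congr fun n => ?_)
  have hc : (1 : ℝ) ≤ n + 1 := by simp
  have hc0 : (0 : ℝ) < n + 1 := n.cast_add_one_pos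
  have hψ := (contDiff_smoothStep (n + 1) a).sub (contDiff_smoothStep (n + 1) b)
  have hφ : ContDiff ℝ (⊤ : ℕ∞)
      fun x : ℝ × E => (smoothStep (n + 1) a x.1 - smoothStep (n + 1) b x.1) * η x.2 :=
    (hψ.comp contDiff_fst).mul (hη.comp contDiff_snd)
  have hφc := hasCompactSupport_smoothStep_sub_mul hηc hab hc
  have hda : Differentiable ℝ (smoothStep (n + 1) a) :=
    (contDiff_smoothStep _ a).differentiable (by simp)
  have hdb : Differentiable ℝ (smoothStep (n + 1) b) :=
    (contDiff_smoothStep _ b).differentiable (by simp)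
  have hfd : ∀ x : ℝ × E, fderiv ℝ
      (fun x : ℝ × E => (smoothStep (n + 1) a x.1 - smoothStep (n + 1) b x.1) * η x.2) x (1, 0)
      = (deriv (smoothStep (n + 1) a) x.1 - deriv (smoothStep (n + 1) b) x.1) * η x.2 := fun x => by
    rw [fderiv_mul_fst_snd_apply (hda.fun_sub hdb) (hη.differentiable (by simp)),
      deriv_fun_sub (hda x.1) (hdb x.1)]
  have hint : Integrable fun x : ℝ × E => f x * fderiv ℝ
      (fun x : ℝ × E => (smoothStep (n + 1) a x.1 - smoothStep (n + 1) b x.1) * η x.2)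
        x (1, 0) :=
    (hf.mul ((hφ.continuous_fderiv (by simp)).clm_apply
      continuous_const)).integrable_of_hasCompactSupport (hφc.fderiv_apply ℝ (1, 0)).mul_left
  have hweak := hfg _ hφ hφc
  simp only [hfd] at hweak hint
  rw [← neg_eq_iff_eq_neg] at hweak
  rw [← hweak, Measure.volume_eq_prod, integral_prod _ hint,
    ← integral_sub (integrable_mul_deriv_smoothStep hF hc0 b)
      (integrable_mul_deriv_smoothStep hF hc0 a), ← integral_neg]
  congr 1 with t
  rw [← mul_sub, ← integral_mul_const, ← integral_neg]
  congr 1 with y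
  ring

theorem ae_locallyIntegrable_fst (hg : LocallyIntegrable g volume) :
    ∀ᵐ y : E, LocallyIntegrable (fun t => g (t, y)) volume := by
  have h : ∀ n : ℕ, ∀ᵐ y : E, y ∈ Metric.closedBall (0 : E) n →
      IntegrableOn (fun t => g (t, y)) (Icc (-n : ℝ) n) := fun n => by
    have hn := hg.integrableOn_isCompact
      ((isCompact_Icc (a := (-n : ℝ)) (b := n)).prod (isCompact_closedBall (0 : E) n))
    rw [IntegrableOn, Measure.volume_eq_prod, ← Measure.prod_restrict] at hn
    exact (ae_restrict_iff' Metric.isClosed_closedBall.measurableSet).1 hn.prod_left_ae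
  filter_upwards [ae_all_iff.2 h] with y hy
  refine locallyIntegrable_iff.2 fun K hK => ?_
  obtain ⟨R, hR⟩ := hK.isBounded.subset_closedBall 0
  obtain ⟨n, hn⟩ := exists_nat_ge (max R ‖y‖)
  refine (hy n ?_).mono_set fun t ht => ?_
  · simpa using (le_max_right _ _).trans hn
  · have := hR ht
    rw [mem_closedBall_zero_iff, Real.norm_eq_abs] at this
    exact abs_le.1 (this.trans ((le_max_left _ _).trans hn))

theorem ae_sub_eq_intervalIntegral_of_weak_deriv (hf : Continuous f)
    (hg : LocallyIntegrable g volume)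
    (hfg : ∀ φ : ℝ × E → ℝ, ContDiff ℝ (⊤ : ℕ∞) φ → HasCompactSupport φ →
      ∫ x, f x * fderiv ℝ φ x (1, 0) = -∫ x, g x * φ x)
    {a b : ℝ} (hab : a ≤ b) : ∀ᵐ y : E, f (b, y) - f (a, y) = ∫ t in a..b, g (t, y) := by
  have hfc : ∀ t, Continuous fun y => f (t, y) := fun t => by fun_prop
  have hG := locallyIntegrable_intervalIntegral_fst hg hab
  have hloc : LocallyIntegrable
      (fun y : E => f (b, y) - f (a, y) - ∫ t in a..b, g (t, y)) volume :=
    (((hfc b).sub (hfc a)).locallyIntegrable).sub hG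
  refine (ae_eq_zero_of_integral_contDiff_smul_eq_zero hloc fun η hη hηc => ?_).mono
    fun y hy => sub_eq_zero.1 hy
  have hfη : ∀ t, Integrable fun y => η y * f (t, y) := fun t =>
    (hη.continuous.mul (hfc t)).integrable_of_hasCompactSupport hηc.mul_right
  have hgη := hG.integrable_smul_left_of_hasCompactSupport hη.continuous hηc
  simp only [smul_eq_mul, mul_sub] at hgη ⊢
  rw [integral_sub (f := fun y => η y * f (b, y) - η y * f (a, y)) ((hfη b).sub (hfη a)) hgη,
    integral_sub (hfη b) (hfη a),
    integral_mul_sub_eq_of_weak_deriv hf hg hfg hη hηc hab, sub_self]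

/-- A continuous function with a weak partial derivative in the first coordinate direction is,
on almost every line in that direction, a primitive of its weak derivative. -/
theorem ae_forall_sub_eq_intervalIntegral_of_weak_deriv (hf : Continuous f)
    (hg : LocallyIntegrable g volume)
    (hfg : ∀ φ : ℝ × E → ℝ, ContDiff ℝ (⊤ : ℕ∞) φ → HasCompactSupport φ →
      ∫ x, f x * fderiv ℝ φ x (1, 0) = -∫ x, g x * φ x) :
    ∀ᵐ y : E, LocallyIntegrable (fun t => g (t, y)) volume ∧
      ∀ a b : ℝ, a ≤ b → f (b, y) - f (a, y) = ∫ t in a..b, g (t, y) := by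
  have h : ∀ p : ℚ × ℚ, ∀ᵐ y : E, (p.1 : ℝ) ≤ p.2 →
      f ((p.2 : ℝ), y) - f ((p.1 : ℝ), y) = ∫ t in (p.1 : ℝ)..p.2, g (t, y) := fun p => by
    by_cases hp : (p.1 : ℝ) ≤ p.2
    · exact (ae_sub_eq_intervalIntegral_of_weak_deriv hf hg hfg hp).mono fun y hy _ => hy
    · exact Eventually.of_forall fun y h => absurd h hp
  filter_upwards [ae_locallyIntegrable_fst hg, ae_all_iff.2 h] with y hgy hy
  refine ⟨hgy, fun a b _ => ?_⟩
  have hii : ∀ a b : ℝ, IntervalIntegrable (fun t => g (t, y)) volume a b := fun a b =>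
    (hgy.integrableOn_isCompact isCompact_uIcc).intervalIntegrable
  have hfun : (fun t => f (t, y) - f (0, y)) = fun t => ∫ s in (0 : ℝ)..t, g (s, y) := by
    refine Continuous.ext_on Rat.isDenseEmbedding_coe_real.dense (by fun_prop)
      (intervalIntegral.continuous_primitive hii 0) ?_
    rintro _ ⟨q, rfl⟩
    rcases le_total (0 : ℝ) q with hq | hq
    · simpa using hy (0, q) (by simpa using hq)
    · have := hy (q, 0) (by simpa using hq)
      simp only [Rat.cast_zero] at this
      simp only [intervalIntegral.integral_symm (q : ℝ) 0, ← this, neg_sub]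
  rw [← intervalIntegral.integral_interval_sub_left (hii 0 b) (hii 0 a), ← congrFun hfun b,
    ← congrFun hfun a, sub_sub_sub_cancel_right]

end Product

/-- Necessity direction of Corollary 1.7: a continuous, locally integrable
function that fails to be absolutely continuous on a set of lines (parallel to
the first axis) of positive `(N-1)`-dimensional outer measure has no weak
partial derivative in the first coordinate direction. -/
theorem no_weak_derivative_of_singular_on_positive_measure_of_lines
    (N : ℕ) (hN : 1 ≤ N)
    (f : ℝ × (Fin (N - 1) → ℝ) → ℝ)
    (hf : Continuous f) (hfl : LocallyIntegrable f volume)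
    (Y : Set (Fin (N - 1) → ℝ)) (hY : 0 < volume Y)
    (hsing : ∀ y ∈ Y, ¬ ∃ h : ℝ → ℝ, LocallyIntegrable h volume ∧
      ∀ a b : ℝ, a ≤ b → f (b, y) - f (a, y) = ∫ t in a..b, h t) :
    ¬ ∃ g : ℝ × (Fin (N - 1) → ℝ) → ℝ, LocallyIntegrable g volume ∧
      ∀ φ : ℝ × (Fin (N - 1) → ℝ) → ℝ, ContDiff ℝ (⊤ : ℕ∞) φ → HasCompactSupport φ →
        ∫ x, f x * fderiv ℝ φ x (1, 0) = -∫ x, g x * φ x := by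
  rintro ⟨g, hg, hfg⟩
  have h := ae_iff.1 (ae_forall_sub_eq_intervalIntegral_of_weak_deriv hf hg hfg)
  refine hY.ne' (measure_mono_null ?_ h)
  exact fun y hy hy' => hsing y hy ⟨_, hy'⟩
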